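/- arXiv:2107.01650 — 2 statements merged into one kernel-verified Lean document; each statement's English description precedes it below -/
import Mathlib

section
/- Let F : ℝ^n → ℝ^n be a bijection such that both F and its inverse F⁻¹ are differentiable, let g be a vector field on ℝ^n, and let f be the pushforward dynamics f(y) = DF(F⁻¹(y))[g(F⁻¹(y))]. Let x* ∈ ℝ^n satisfy g(x*) = 0, and suppose there exists δ > 0 such that every integral curve x of g with ‖x(0) − x*‖ < δ satisfies x(t) → x* as t → ∞. Then there exists δ' > 0 such that every integral curve y of f with ‖y(0) − F(x*)‖ < δ' satisfies y(t) → F(x*) as t → ∞. -/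
/-- The derivative of a differentiable left inverse is a left inverse of the derivative. -/
theorem fderiv_leftInverse_of_leftInverse {E E' : Type*}
    [NormedAddCommGroup E] [NormedSpace ℝ E] [NormedAddCommGroup E'] [NormedSpace ℝ E']
    {F : E → E'} {G : E' → E} (hFG : Function.LeftInverse G F) {p : E}
    (hF : DifferentiableAt ℝ F p) (hG : DifferentiableAt ℝ G (F p)) :
    Function.LeftInverse (fderiv ℝ G (F p)) (fderiv ℝ F p) := by
  intro v
  have h : HasFDerivAt (G ∘ F) ((fderiv ℝ G (F p)).comp (fderiv ℝ F p)) p :=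
    hG.hasFDerivAt.comp p hF.hasFDerivAt
  rw [hFG.comp_eq_id] at h
  exact DFunLike.congr_fun (h.unique (hasFDerivAt_id p)) v

/-- A differentiable inverse `G` of `F` sends integral curves of the pushforward of `g` under `F`
to integral curves of `g`. -/
theorem hasDerivAt_comp_of_pushforward {E E' : Type*}
    [NormedAddCommGroup E] [NormedSpace ℝ E] [NormedAddCommGroup E'] [NormedSpace ℝ E']
    {F : E → E'} {G : E' → E} (hFG : Function.LeftInverse G F)
    (hGF : Function.RightInverse G F) (hF : Differentiable ℝ F) (hG : Differentiable ℝ G)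
    {g : E → E} {y : ℝ → E'} {t : ℝ}
    (hy : HasDerivAt y (fderiv ℝ F (G (y t)) (g (G (y t)))) t) :
    HasDerivAt (G ∘ y) (g (G (y t))) t := by
  have h := (hG (y t)).hasFDerivAt.comp_hasDerivAt t hy
  have hinv := fderiv_leftInverse_of_leftInverse hFG (hF (G (y t))) (hG _) (g (G (y t)))
  rw [hGF (y t)] at hinv
  rwa [hinv] at h


/-- Asymptotic stability of an equilibrium point is preserved under pushforward of the
dynamics by a differentiable bijection with differentiable inverse. -/
theorem stmt_6 (n : ℕ) (F G : (Fin n → ℝ) → (Fin n → ℝ))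
    (hFG : Function.LeftInverse G F) (hGF : Function.RightInverse G F)
    (hF : Differentiable ℝ F) (hG : Differentiable ℝ G)
    (g f : (Fin n → ℝ) → (Fin n → ℝ))
    (hf : ∀ y, f y = fderiv ℝ F (G y) (g (G y)))
    (xstar : Fin n → ℝ) (hx : g xstar = 0)
    (δ : ℝ) (hδ : 0 < δ)
    (hstab : ∀ x : ℝ → (Fin n → ℝ), (∀ t, HasDerivAt x (g (x t)) t) →
      ‖x 0 - xstar‖ < δ → Filter.Tendsto x Filter.atTop (nhds xstar)) :
    ∃ δ' : ℝ, 0 < δ' ∧ ∀ y : ℝ → (Fin n → ℝ), (∀ t, HasDerivAt y (f (y t)) t) →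
      ‖y 0 - F xstar‖ < δ' → Filter.Tendsto y Filter.atTop (nhds (F xstar)) := by
  have hnear : ∀ᶠ p in nhds (F xstar), ‖G p - xstar‖ < δ := by
    have h := (hG (F xstar)).continuousAt.eventually (Metric.ball_mem_nhds _ hδ)
    simpa only [hFG xstar, Metric.mem_ball, dist_eq_norm] using h
  obtain ⟨δ', hδ', hball⟩ := Metric.eventually_nhds_iff.mp hnear
  refine ⟨δ', hδ', fun y hy hy0 => ?_⟩
  have hlim : Filter.Tendsto (G ∘ y) Filter.atTop (nhds xstar) :=
    hstab (G ∘ y)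
      (fun t => hasDerivAt_comp_of_pushforward hFG hGF hF hG (hf (y t) ▸ hy t))
      (hball (by rwa [dist_eq_norm]))
  simpa only [Function.comp_def, hGF _] using (hF xstar).continuousAt.tendsto.comp hlim
end

section
/- Let A be a real n × n matrix admitting a basis of real eigenvectors: there exist λ : Fin n → ℝ and r : Fin n → ℝ^n with A·r_k = λ_k r_k for each k, {r_k} spanning ℝ^n, and λ_k < 0 for every k. Then every curve x : ℝ → ℝ^n satisfying, for all t ∈ ℝ, that x has derivative A·x(t) at t, converges to 0: x(t) → 0 as t → ∞. -/
theorem eq_exp_mul_of_hasDerivAt {c : ℝ → ℝ} {a : ℝ}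
    (hc : ∀ t, HasDerivAt c (a * c t) t) (t : ℝ) : c t = Real.exp (a * t) * c 0 := by
  have hd (s : ℝ) : HasDerivAt (fun s => Real.exp (-(a * s)) * c s) 0 s := by
    have h : HasDerivAt (fun s => Real.exp (-(a * s))) (Real.exp (-(a * s)) * -a) s :=
      (hasDerivAt_const_mul a).fun_neg.exp
    exact (h.fun_mul (hc s)).congr_deriv (by ring)
  have h := is_const_of_deriv_eq_zero (fun s => (hd s).differentiableAt)
    (fun s => (hd s).deriv) t 0
  simp only [mul_zero, neg_zero, Real.exp_zero, one_mul] at h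
  rw [← h, ← mul_assoc, ← Real.exp_add, add_neg_cancel, Real.exp_zero, one_mul]

theorem tendsto_zero_of_hasDerivAt_mul {c : ℝ → ℝ} {a : ℝ} (ha : a < 0)
    (hc : ∀ t, HasDerivAt c (a * c t) t) : Filter.Tendsto c Filter.atTop (nhds 0) := by
  rw [funext (eq_exp_mul_of_hasDerivAt hc)]
  simpa using (Real.tendsto_exp_atBot.comp
    (Filter.tendsto_id.const_mul_atTop_of_neg ha)).mul_const (c 0)

/-- If `A` has a spanning set of real eigenvectors with negative eigenvalues, then
every solution of `x' = A x` converges to `0` as `t → ∞`. -/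
theorem stmt_10 (n : ℕ) (A : Matrix (Fin n) (Fin n) ℝ)
    (μ : Fin n → ℝ) (r : Fin n → (Fin n → ℝ))
    (hr : ∀ k, A.mulVec (r k) = μ k • r k)
    (hspan : Submodule.span ℝ (Set.range r) = ⊤)
    (hneg : ∀ k, μ k < 0) :
    ∀ x : ℝ → (Fin n → ℝ), (∀ t, HasDerivAt x (A.mulVec (x t)) t) →
      Filter.Tendsto x Filter.atTop (nhds 0) := by
  intro x hx
  let b := Module.Basis.mk
    (linearIndependent_of_top_le_span_of_card_eq_finrank hspan.ge (by simp)) hspan.ge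
  have hb (k : Fin n) : b k = r k := Module.Basis.mk_apply _ _ k
  have hcoord (k : Fin n) : b.coord k ∘ₗ A.mulVecLin = μ k • b.coord k := by
    refine b.ext fun j => ?_
    have hj : A.mulVec (b j) = μ j • b j := by rw [hb, hr]
    rcases eq_or_ne j k with rfl | hjk
    · simp [hj]
    · simp [hj, Finsupp.single_eq_of_ne hjk.symm]
  have hlim (k : Fin n) :
      Filter.Tendsto (fun t => b.coord k (x t)) Filter.atTop (nhds 0) := by
    refine tendsto_zero_of_hasDerivAt_mul (hneg k) fun t => ?_
    have h := (b.coord k).toContinuousLinearMap.hasFDerivAt.comp_hasDerivAt t (hx t)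
    exact h.congr_deriv (LinearMap.congr_fun (hcoord k) (x t))
  have hsum : x = fun t => ∑ k, b.coord k (x t) • b k :=
    funext fun t => (b.sum_repr (x t)).symm
  rw [hsum]
  simpa using tendsto_finsetSum Finset.univ fun k _ => (hlim k).smul_const (b k)
end
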